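/- Let m ≥ 1 and let a be a positive integer. The entries of the matrices Λ⁺_m(q,a) := R_m(q)^a W_m and Λ⁻_m(q,a) := W_m L_m(q)^a over ℤ[q] are given, for i+j ≤ m+2, by (Λ⁺_m(q,a))_{ij} = q^{(j−1)a} · mbinom(a, m+2−i−j)_q and (Λ⁻_m(q,a))_{ij} = q^{m+2−i−j} · q^{(i−1)a} · mbinom(a, m+2−i−j)_q, and both entries are 0 when i+j > m+2. -/

import Mathlib

open Polynomial Finset

namespace QHCF

noncomputable section

/-! ### Border strips and P-partitions -/

/-- The full alternating step list: `replicate a₁ b ++ replicate a₂ (!b) ++ ⋯`. -/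
def fullSteps : List ℕ → Bool → List Bool
  | [], _ => []
  | x :: xs, b => List.replicate x b ++ fullSteps xs (!b)

/-- The step sequence of the border strip `𝒢[a₁,…,aₙ]`: `(a₁−1)` up steps (`true`),
then `a₂` right steps (`false`), then `a₃` up steps, alternating, ending with
`(aₙ−1)` final steps. -/
def steps (a : List ℕ) : List Bool := ((fullSteps a true).drop 1).dropLast

/-- The number of boxes `N = a₁+⋯+aₙ−1` of the border strip `𝒢[a₁,…,aₙ]`. -/
def boxCount (a : List ℕ) : ℕ := a.sum - 1

/-- `σ` is a P-partition on `𝒢[a₁,…,aₙ]` with parts at most `m`: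
`σ(t+1) ≤ σ(t)` on up steps and `σ(t) ≤ σ(t+1)` on right steps. -/
def IsPP (m : ℕ) (a : List ℕ) (σ : Fin (boxCount a) → Fin (m + 1)) : Prop :=
  ∀ (t : ℕ) (h : t + 1 < boxCount a),
    if (steps a).getD t true
    then ((σ ⟨t + 1, h⟩ : ℕ) ≤ (σ ⟨t, Nat.lt_of_succ_lt h⟩ : ℕ))
    else ((σ ⟨t, Nat.lt_of_succ_lt h⟩ : ℕ) ≤ (σ ⟨t + 1, h⟩ : ℕ))

/-- The set of P-partitions on `𝒢[a₁,…,aₙ]` with parts at most `m`. -/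
noncomputable def PP (m : ℕ) (a : List ℕ) : Finset (Fin (boxCount a) → Fin (m + 1)) :=
  @Finset.filter _ (IsPP m a) (Classical.decPred _) Finset.univ

/-- The weight of a P-partition: the sum of its parts. -/
def wt {N m : ℕ} (σ : Fin N → Fin (m + 1)) : ℕ := ∑ t, (σ t : ℕ)

/-- The number of P-partitions (parts at most `m`) satisfying a further predicate `p`. -/
noncomputable def PPcount (m : ℕ) (a : List ℕ)
    (p : (Fin (boxCount a) → Fin (m + 1)) → Prop) : ℕ :=
  (@Finset.filter _ p (Classical.decPred _) (PP m a)).card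

/-- The weight generating function `Σ q^{wt σ}` over P-partitions satisfying `p`. -/
noncomputable def PPgen (m : ℕ) (a : List ℕ)
    (p : (Fin (boxCount a) → Fin (m + 1)) → Prop) : Polynomial ℤ :=
  ∑ σ ∈ @Finset.filter _ p (Classical.decPred _) (PP m a), (X : Polynomial ℤ) ^ wt σ

/-- `Ω_m(𝒢,q)`: the weight generating function of all P-partitions with parts at most `m`. -/
noncomputable def Omega (m : ℕ) (a : List ℕ) : Polynomial ℤ := PPgen m a fun _ => True

/-- Generating function over P-partitions with first part `≤ b` and last part `≤ c`. -/
noncomputable def OmegaLE (m : ℕ) (a : List ℕ) (b c : ℕ) : Polynomial ℤ :=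
  PPgen m a fun σ =>
    (∀ h : 0 < boxCount a, (σ ⟨0, h⟩ : ℕ) ≤ b) ∧
    (∀ h : 0 < boxCount a, (σ ⟨boxCount a - 1, Nat.sub_lt h Nat.one_pos⟩ : ℕ) ≤ c)

/-- Generating function over P-partitions with first part `≤ b` and last part `≥ c`. -/
noncomputable def OmegaGE (m : ℕ) (a : List ℕ) (b c : ℕ) : Polynomial ℤ :=
  PPgen m a fun σ =>
    (∀ h : 0 < boxCount a, (σ ⟨0, h⟩ : ℕ) ≤ b) ∧
    (∀ h : 0 < boxCount a, c ≤ (σ ⟨boxCount a - 1, Nat.sub_lt h Nat.one_pos⟩ : ℕ))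

/-! ### Matrices over ℤ -/

/-- `R_m`, the `(m+1)×(m+1)` upper-triangular matrix of ones. -/
def Rmat (m : ℕ) : Matrix (Fin (m + 1)) (Fin (m + 1)) ℤ :=
  Matrix.of fun i j => if i ≤ j then 1 else 0

/-- `W_m`, the antidiagonal permutation matrix (`(W_m)_{ij} = 1` iff `i+j = m+2`, 1-based). -/
def Wmat (m : ℕ) : Matrix (Fin (m + 1)) (Fin (m + 1)) ℤ :=
  Matrix.of fun i j => if (i : ℕ) + 1 + ((j : ℕ) + 1) = m + 2 then 1 else 0

/-- `Λ_m(a) = R_m^a · W_m`. -/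
def Lam (m a : ℕ) : Matrix (Fin (m + 1)) (Fin (m + 1)) ℤ := Rmat m ^ a * Wmat m

/-- The product `Λ_m(a₁)Λ_m(a₂)⋯Λ_m(aₙ)`. -/
def LamProd (m : ℕ) (a : List ℕ) : Matrix (Fin (m + 1)) (Fin (m + 1)) ℤ :=
  (a.map fun x => Lam m x).prod

/-! ### q-deformed matrices over ℤ[q] (with `q = Polynomial.X`) -/

/-- `R_m` as a matrix over `ℤ[q]`. -/
def RmatQ (m : ℕ) : Matrix (Fin (m + 1)) (Fin (m + 1)) (Polynomial ℤ) :=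
  Matrix.of fun i j => if i ≤ j then 1 else 0

/-- `L_m = R_m^⊤` as a matrix over `ℤ[q]`. -/
def LmatQ (m : ℕ) : Matrix (Fin (m + 1)) (Fin (m + 1)) (Polynomial ℤ) := (RmatQ m).transpose

/-- `Q_m = diag(q^m, q^{m-1}, …, q, 1)`. -/
def Qmat (m : ℕ) : Matrix (Fin (m + 1)) (Fin (m + 1)) (Polynomial ℤ) :=
  Matrix.diagonal fun i => X ^ (m - (i : ℕ))

/-- `R_m(q) := R_m · Q_m`. -/
def Rq (m : ℕ) : Matrix (Fin (m + 1)) (Fin (m + 1)) (Polynomial ℤ) := RmatQ m * Qmat m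

/-- `L_m(q) := L_m · Q_m`. -/
def Lq (m : ℕ) : Matrix (Fin (m + 1)) (Fin (m + 1)) (Polynomial ℤ) := LmatQ m * Qmat m

/-- `W_m` as a matrix over `ℤ[q]`. -/
def WmatQ (m : ℕ) : Matrix (Fin (m + 1)) (Fin (m + 1)) (Polynomial ℤ) :=
  Matrix.of fun i j => if (i : ℕ) + 1 + ((j : ℕ) + 1) = m + 2 then 1 else 0

/-- `Λ⁺_m(q,a) := R_m(q)^a · W_m`. -/
def LamP (m a : ℕ) : Matrix (Fin (m + 1)) (Fin (m + 1)) (Polynomial ℤ) := Rq m ^ a * WmatQ m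

/-- `Λ⁻_m(q,a) := W_m · L_m(q)^a`. -/
def LamM (m a : ℕ) : Matrix (Fin (m + 1)) (Fin (m + 1)) (Polynomial ℤ) := WmatQ m * Lq m ^ a

/-- Alternating product of `Λ⁺`/`Λ⁻` matrices (`b = true` starts with `Λ⁺`). -/
def altLam (m : ℕ) : List ℕ → Bool → Matrix (Fin (m + 1)) (Fin (m + 1)) (Polynomial ℤ)
  | [], _ => 1
  | x :: xs, b => (if b then LamP m x else LamM m x) * altLam m xs (!b)

/-- `X_𝒢(q) = Λ⁺_m(q,a₁)Λ⁻_m(q,a₂)Λ⁺_m(q,a₃)⋯`. -/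
def XG (m : ℕ) (a : List ℕ) : Matrix (Fin (m + 1)) (Fin (m + 1)) (Polynomial ℤ) :=
  altLam m a true

/-- Alternating product of powers of `R_m(q)` and `L_m(q)` (`b = true` starts with `R`). -/
def altRL (m : ℕ) : List ℕ → Bool → Matrix (Fin (m + 1)) (Fin (m + 1)) (Polynomial ℤ)
  | [], _ => 1
  | x :: xs, b => (if b then Rq m ^ x else Lq m ^ x) * altRL m xs (!b)

/-- `R_m(q)^{a₁} L_m(q)^{a₂} R_m(q)^{a₃} ⋯`. -/
def RLProd (m : ℕ) (a : List ℕ) : Matrix (Fin (m + 1)) (Fin (m + 1)) (Polynomial ℤ) :=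
  altRL m a true

/-! ### Gaussian binomial coefficients -/

/-- The Gaussian binomial coefficient `binom(n,k)_q ∈ ℤ[q]`, defined via the
q-Pascal recursion `binom(n,k)_q = binom(n−1,k−1)_q + q^k·binom(n−1,k)_q`;
it equals `[n]_q!/([k]_q![n−k]_q!)`. -/
def qbinom : ℕ → ℕ → Polynomial ℤ
  | _, 0 => 1
  | 0, _ + 1 => 0
  | n + 1, k + 1 => qbinom n k + X ^ (k + 1) * qbinom n (k + 1)

/-- The q-multichoose coefficient `mbinom(n,k)_q := binom(n+k−1,k)_q`. -/
def qmbinom (n k : ℕ) : Polynomial ℤ := qbinom (n + k - 1) k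

/-! ### Higher q-continued fractions -/

/-- The higher q-continued fraction
`r^q_{i,m}(a₁,…,aₙ) := Ω_m^{m+1−i,1}(𝒢,q) · (Ω_m^{m+1,1}(𝒢,q))⁻¹ ∈ ℤ⟦q⟧`,
i.e. the generating function over P-partitions with first part `≤ i`, divided by the
one over P-partitions with first part `= 0` (whose constant term is `1`). -/
noncomputable def rq (m i : ℕ) (a : List ℕ) : PowerSeries ℤ :=
  (↑(OmegaLE m a i m) : PowerSeries ℤ) *
    PowerSeries.invOfUnit (↑(OmegaLE m a 0 m) : PowerSeries ℤ) 1

/-- The value `v(a₁,…,aₙ)` of a finite continued fraction `a₁ + 1/(a₂ + 1/(⋯))`. -/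
def cfVal : List ℕ → ℚ
  | [] => 1
  | [x] => (x : ℚ)
  | x :: y :: xs => (x : ℚ) + 1 / cfVal (y :: xs)

end

end QHCF

open QHCF

namespace QHCF

theorem qbinom_eq_zero_of_lt : ∀ {n k : ℕ}, n < k → qbinom n k = 0
  | 0, k + 1, _ => by simp [qbinom]
  | n + 1, k + 1, h => by
    rw [qbinom, qbinom_eq_zero_of_lt (by omega : n < k),
      qbinom_eq_zero_of_lt (by omega : n < k + 1)]
    simp

theorem qmbinom_zero_right (a : ℕ) : qmbinom a 0 = 1 := by
  simp [qmbinom, qbinom]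

theorem qmbinom_zero_left {k : ℕ} (hk : k ≠ 0) : qmbinom 0 k = 0 :=
  qbinom_eq_zero_of_lt (by omega)

theorem qmbinom_succ_succ (a k : ℕ) :
    qmbinom (a + 1) (k + 1) = qmbinom (a + 1) k + X ^ (k + 1) * qmbinom a (k + 1) := by
  have h₁ : a + 1 + (k + 1) - 1 = a + k + 1 := by omega
  have h₂ : a + 1 + k - 1 = a + k := by omega
  have h₃ : a + (k + 1) - 1 = a + k := by omega
  rw [qmbinom, qmbinom, qmbinom, h₁, h₂, h₃, qbinom]

theorem sum_X_pow_mul_qmbinom (a d : ℕ) :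
    ∑ s ∈ range (d + 1), X ^ s * qmbinom a s = qmbinom (a + 1) d := by
  induction d with
  | zero => simp [qmbinom_zero_right]
  | succ d ih => rw [sum_range_succ, ih, qmbinom_succ_succ]

theorem Rq_apply (m : ℕ) (i j : Fin (m + 1)) :
    Rq m i j = if i ≤ j then X ^ (m - (j : ℕ)) else 0 := by
  simp [Rq, Qmat, RmatQ, Matrix.mul_diagonal]

theorem Rq_pow_apply (m a : ℕ) (i k : Fin (m + 1)) :
    (Rq m ^ a) i k =
      if i ≤ k then X ^ ((m - (k : ℕ)) * a) * qmbinom a ((k : ℕ) - i) else 0 := by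
  induction a generalizing i with
  | zero =>
    rw [pow_zero, Matrix.one_apply]
    split_ifs with h₁ h₂ h₂
    · simp [h₁, qmbinom_zero_right]
    · exact absurd h₁.le h₂
    · rw [qmbinom_zero_left (by omega), mul_zero]
    · rfl
  | succ a ih =>
    rw [pow_succ', Matrix.mul_apply]
    simp only [ih, Rq_apply, ite_mul, mul_ite, zero_mul, mul_zero, ← ite_and, ← sum_filter]
    split_ifs with h
    · rw [← sum_X_pow_mul_qmbinom, mul_sum]
      refine sum_bij' (fun l _ => (k : ℕ) - l)
        (fun s _ => ⟨(k : ℕ) - s, by omega⟩) ?_ ?_ ?_ ?_ ?_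
      · intro l hl
        simp only [mem_filter, mem_univ, true_and, Fin.le_def, mem_range] at hl ⊢
        omega
      · intro s hs
        simp only [mem_filter, mem_univ, true_and, Fin.le_def, mem_range] at hs h ⊢
        omega
      · intro l hl
        simp only [mem_filter, mem_univ, true_and, Fin.le_def] at hl
        ext
        simp only
        omega
      · intro s hs
        simp only [mem_range, Fin.le_def] at hs h ⊢
        omega
      · intro l hl
        simp only [mem_filter, mem_univ, true_and, Fin.le_def] at hl
        have e : m - (l : ℕ) = (m - (k : ℕ)) + ((k : ℕ) - l) := by omega
        rw [e]
        ring
    · refine sum_eq_zero fun l hl => ?_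
      simp only [mem_filter, mem_univ, true_and] at hl
      exact absurd (by order) h

theorem Qmat_mul_Lq_pow (m a : ℕ) : Qmat m * Lq m ^ a = (Rq m ^ a).transpose * Qmat m := by
  have h : SemiconjBy (Qmat m) (Lq m) (Rq m).transpose := by
    simp [SemiconjBy, Lq, LmatQ, Rq, Qmat, Matrix.transpose_mul, Matrix.mul_assoc]
  rw [Matrix.transpose_pow]
  exact h.pow_right a

theorem Lq_pow_apply (m a : ℕ) (k j : Fin (m + 1)) :
    (Lq m ^ a) k j =
      if j ≤ k then X ^ ((k : ℕ) - j) * (X ^ ((m - (k : ℕ)) * a) * qmbinom a ((k : ℕ) - j))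
      else 0 := by
  have h := congrFun (congrFun (Qmat_mul_Lq_pow m a) k) j
  rw [Qmat, Matrix.diagonal_mul, Matrix.mul_diagonal, Matrix.transpose_apply,
    Rq_pow_apply] at h
  refine mul_left_cancel₀ (pow_ne_zero (m - (k : ℕ)) X_ne_zero) (h.trans ?_)
  split_ifs with hjk
  · have e : m - (j : ℕ) = (m - (k : ℕ)) + ((k : ℕ) - j) := by omega
    rw [e]
    ring
  · simp

theorem WmatQ_apply (m : ℕ) (i j : Fin (m + 1)) :
    WmatQ m i j = if i = j.rev then 1 else 0 := by
  simp only [WmatQ, Matrix.of_apply, Fin.ext_iff, Fin.val_rev]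
  congr 1
  apply propext
  omega

theorem LamP_apply (m a : ℕ) (i j : Fin (m + 1)) :
    LamP m a i j = (Rq m ^ a) i j.rev := by
  simp [LamP, Matrix.mul_apply, WmatQ_apply]

theorem LamM_apply (m a : ℕ) (i j : Fin (m + 1)) :
    LamM m a i j = (Lq m ^ a) i.rev j := by
  simp [LamM, Matrix.mul_apply, WmatQ_apply, ← Fin.rev_eq_iff]

end QHCF

/-- Entries of `Λ⁺_m(q,a) = R_m(q)^a·W_m` and `Λ⁻_m(q,a) = W_m·L_m(q)^a`
(1-based indices): for `i+j ≤ m+2`, `(Λ⁺)_{ij} = q^{(j−1)a}·mbinom(a, m+2−i−j)_q` and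
`(Λ⁻)_{ij} = q^{m+2−i−j}·q^{(i−1)a}·mbinom(a, m+2−i−j)_q`; both vanish for `i+j > m+2`. -/
theorem statement6 (m a : ℕ) (hm : 1 ≤ m) (ha : 1 ≤ a)
    (i j : ℕ) (hi1 : 1 ≤ i) (hi2 : i ≤ m + 1) (hj1 : 1 ≤ j) (hj2 : j ≤ m + 1) :
    (i + j ≤ m + 2 →
      LamP m a ⟨i - 1, by omega⟩ ⟨j - 1, by omega⟩ =
        X ^ ((j - 1) * a) * qmbinom a (m + 2 - i - j) ∧
      LamM m a ⟨i - 1, by omega⟩ ⟨j - 1, by omega⟩ =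
        X ^ (m + 2 - i - j) * (X ^ ((i - 1) * a) * qmbinom a (m + 2 - i - j))) ∧
    (m + 2 < i + j →
      LamP m a ⟨i - 1, by omega⟩ ⟨j - 1, by omega⟩ = 0 ∧
      LamM m a ⟨i - 1, by omega⟩ ⟨j - 1, by omega⟩ = 0) := by
  rw [LamP_apply, LamM_apply, Rq_pow_apply, Lq_pow_apply]
  simp only [Fin.le_def, Fin.val_rev]
  have hj : m - (m + 1 - (j - 1 + 1)) = j - 1 := by omega
  have hi : m - (m + 1 - (i - 1 + 1)) = i - 1 := by omega
  have hd₁ : m + 1 - (j - 1 + 1) - (i - 1) = m + 2 - i - j := by omega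
  have hd₂ : m + 1 - (i - 1 + 1) - (j - 1) = m + 2 - i - j := by omega
  rw [hj, hi, hd₁, hd₂]
  refine ⟨fun h => ⟨if_pos ?_, if_pos ?_⟩, fun h => ⟨if_neg ?_, if_neg ?_⟩⟩ <;> omega
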